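/- Let (X, τ, g) be a first countable premetric space. Suppose that for every x₀ ∈ X and every set-valued map S : X ⇒ X satisfying property (∗₂) at x₀, at least one of the following holds: (a) there is an S-orbit starting at x₀ with infinite g-length; (b) there is x ∈ X with S(x) = ∅. Then (X, τ, g) is Σ_g-semicomplete. -/

import Mathlib

open Filter Topology

/-- Theorem (LOEV inverse). If in a first countable premetric space, for every
x₀ and every S satisfying (∗₂) at x₀ either some S-orbit from x₀ has infinite g-length or
some x has S(x) = ∅, then the space is Σ_g-semicomplete. -/
theorem stmt_7 {X : Type*} [TopologicalSpace X] [FirstCountableTopology X]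
    (g : X → X → ℝ)
    (hg0 : ∀ x : X, g x x = 0) (hgpos : ∀ x y : X, x ≠ y → 0 < g x y)
    (hgcont : ∀ x : X, Continuous (g x))
    (hyp : ∀ (x₀ : X) (S : X → Set X),
      (∀ x : X, x ∉ S x) →
      (∀ u : ℕ → X, u 0 = x₀ → (∀ i, u (i + 1) ∈ S (u i)) →
        ∀ φ : ℕ → ℕ, StrictMono φ → ∀ x : X, Tendsto (u ∘ φ) atTop (𝓝 x) →
        ∀ y ∈ S x, ∃ ψ : ℕ → ℕ, StrictMono ψ ∧ ∀ j, y ∈ S (u (φ (ψ j)))) →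
      ((∃ u : ℕ → X, u 0 = x₀ ∧ (∀ i, u (i + 1) ∈ S (u i)) ∧
          ¬ Summable (fun i => g (u (i + 1)) (u i))) ∨
       (∃ x : X, S x = ∅))) :
    -- Σ_g-semicompleteness
    ∀ u : ℕ → X, Summable (fun i => g (u (i + 1)) (u i)) →
      ∃ φ : ℕ → ℕ, StrictMono φ ∧ ∃ x : X, Tendsto (u ∘ φ) atTop (𝓝 x) := by
  classical
  intro u hu
  by_contra hno
  -- every value of `u` has a last occurrence
  have hL : ∀ x : X, ∃ n : ℕ, x ∈ Set.range u → u n = x ∧ ∀ m, u m = x → m ≤ n := by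
    intro x
    by_cases hx : x ∈ Set.range u
    · by_cases hb : ∃ N, ∀ m, u m = x → m ≤ N
      · obtain ⟨N, hN⟩ := hb
        obtain ⟨k, hk⟩ := hx
        refine ⟨Nat.findGreatest (fun m => u m = x) N, fun _ => ⟨?_, fun m hm => ?_⟩⟩
        · exact Nat.findGreatest_spec (P := fun m => u m = x) (hN k hk) hk
        · exact Nat.le_findGreatest (hN m hm) hm
      · exfalso
        push Not at hb
        obtain ⟨φ, hφ, hφ2⟩ := Nat.exists_strictMono_subsequence (P := fun m => u m = x)
          (fun N => by
            obtain ⟨m, h1, h2⟩ := hb N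
            exact ⟨m, h2, h1⟩)
        refine hno ⟨φ, hφ, x, ?_⟩
        have : u ∘ φ = fun _ => x := funext hφ2
        rw [this]
        exact tendsto_const_nhds
    · exact ⟨0, fun h => absurd h hx⟩
  choose L hL using hL
  have key : ∀ v : ℕ → X, v 0 = u 0 →
      (∀ i, v (i + 1) ∈ (if v i ∈ Set.range u then {u (L (v i) + 1)} else {u 0} : Set X)) →
      StrictMono (fun i => L (v i)) ∧ (∀ i, u (L (v i)) = v i) ∧
        ∀ i, v (i + 1) = u (L (v i) + 1) := by
    intro v h0 hv
    have hr : ∀ i, v i ∈ Set.range u := by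
      intro i
      induction i with
      | zero => exact ⟨0, h0.symm⟩
      | succ k ih =>
        have := hv k
        rw [if_pos ih] at this
        exact ⟨_, this.symm⟩
    have hs : ∀ i, v (i + 1) = u (L (v i) + 1) := by
      intro i
      have := hv i
      rw [if_pos (hr i)] at this
      exact this
    refine ⟨strictMono_nat_of_lt_succ fun i => ?_, fun i => (hL _ (hr i)).1, hs⟩
    exact (hL _ (hr (i + 1))).2 _ (hs i).symm
  have hS := hyp (u 0) (fun x => if x ∈ Set.range u then {u (L x + 1)} else {u 0}) ?_ ?_
  rotate_left
  · intro x hx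
    by_cases h : x ∈ Set.range u
    · simp only [if_pos h] at hx
      have := (hL x h).2 _ (Set.mem_singleton_iff.1 hx).symm
      omega
    · simp only [if_neg h] at hx
      exact h ⟨0, (Set.mem_singleton_iff.1 hx).symm⟩
  · intro v h0 hv φ hφ x hx
    obtain ⟨hm, h1, -⟩ := key v h0 hv
    refine absurd ⟨fun i => L (v (φ i)), hm.comp hφ, x, ?_⟩ hno
    refine hx.congr fun i => ?_
    simp only [Function.comp, h1]
  rcases hS with ⟨v, h0, hv, hns⟩ | ⟨x, hx⟩
  · obtain ⟨hm, h1, h2⟩ := key v h0 hv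
    apply hns
    have := hu.comp_injective hm.injective
    refine this.congr fun i => ?_
    simp only [Function.comp, h1, h2]
  · by_cases h : x ∈ Set.range u
    · simp only [if_pos h] at hx
      exact Set.singleton_ne_empty _ hx
    · simp only [if_neg h] at hx
      exact Set.singleton_ne_empty _ hx
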